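/- arXiv:math/9906135 — 5 statements merged into one kernel-verified Lean document; each statement's English description precedes it below -/
import Mathlib

section
/- There exists a unique linear map φ : Dual(L₊) → L such that φ(x ∘ ι) = r̃ᵀ(x) for every x ∈ Dual(L), where ι : L₊ → L is the subspace inclusion (so x ∘ ι is the restriction of x to L₊). Moreover φ is injective and its range is exactly L₋; in particular the dual space Dual(L₊) is linearly isomorphic to L₋. -/
open TensorProduct

/-- The two contractions of a tensor `r` are transposes of each other:
`y ((id ⊗ x) r) = x ((y ⊗ id) r)`. -/
theorem dual_apply_rid_map_eq {k L : Type*} [Field k] [AddCommGroup L] [Module k L]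
    (r : L ⊗[k] L) (x y : Module.Dual k L) :
    y (TensorProduct.rid k L (TensorProduct.map LinearMap.id x r)) =
      x (TensorProduct.lid k L (TensorProduct.map y LinearMap.id r)) := by
  induction r using TensorProduct.induction_on with
  | zero => simp
  | tmul a b => simp [mul_comm]
  | add a b ha hb => simp only [map_add, ha, hb]

/-- For `r ∈ L ⊗ L` with `r̃ x = (x ⊗ id) r`, `r̃ᵀ x = (id ⊗ x) r`,
`L₊ = range r̃`, `L₋ = range r̃ᵀ`, there is a unique linear map
`φ : Dual(L₊) → L` with `φ (x ∘ ι) = r̃ᵀ x` for all `x`; moreover any such `φ` is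
injective with range `L₋`, so `Dual(L₊) ≃ₗ L₋`. -/
theorem stmt_0 (k : Type*) [Field k] (L : Type*) [AddCommGroup L] [Module k L]
    [FiniteDimensional k L] (r : L ⊗[k] L)
    (rPlus rMinus : Module.Dual k L →ₗ[k] L)
    (hPlus : ∀ x : Module.Dual k L,
      rPlus x = (TensorProduct.lid k L) ((TensorProduct.map x LinearMap.id) r))
    (hMinus : ∀ x : Module.Dual k L,
      rMinus x = (TensorProduct.rid k L) ((TensorProduct.map LinearMap.id x) r))
    (Lp Lm : Submodule k L) (hLp : Lp = LinearMap.range rPlus)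
    (hLm : Lm = LinearMap.range rMinus) :
    (∃! φ : Module.Dual k Lp →ₗ[k] L,
        ∀ x : Module.Dual k L, φ (x.comp Lp.subtype) = rMinus x) ∧
    (∀ φ : Module.Dual k Lp →ₗ[k] L,
        (∀ x : Module.Dual k L, φ (x.comp Lp.subtype) = rMinus x) →
        Function.Injective φ ∧ LinearMap.range φ = Lm) ∧
    Nonempty (Module.Dual k Lp ≃ₗ[k] Lm) := by
  subst hLp hLm
  have pairing (x y : Module.Dual k L) : y (rMinus x) = x (rPlus y) := by
    rw [hPlus, hMinus, dual_apply_rid_map_eq]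
  have restrict_eq_zero_iff (x : Module.Dual k L) :
      x.comp (LinearMap.range rPlus).subtype = 0 ↔ rMinus x = 0 := by
    rw [← Module.forall_dual_apply_eq_zero_iff k (rMinus x)]
    simp [pairing, LinearMap.ext_iff]
  have restrict_surjective : Function.Surjective
      fun x : Module.Dual k L => x.comp (LinearMap.range rPlus).subtype :=
    fun f => LinearMap.exists_extend f
  have injective_and_range (φ : Module.Dual k (LinearMap.range rPlus) →ₗ[k] L)
      (hφ : ∀ x : Module.Dual k L, φ (x.comp (LinearMap.range rPlus).subtype) = rMinus x) :
      Function.Injective φ ∧ LinearMap.range φ = LinearMap.range rMinus := by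
    constructor
    · rw [injective_iff_map_eq_zero]
      intro f hf
      obtain ⟨x, rfl⟩ := restrict_surjective f
      exact (restrict_eq_zero_iff x).2 ((hφ x).symm.trans hf)
    · apply SetLike.coe_injective
      rw [LinearMap.coe_range, LinearMap.coe_range, ← restrict_surjective.range_comp]
      exact congrArg Set.range (funext hφ)
  obtain ⟨s, hs⟩ := (LinearMap.range rPlus).subtype.dualMap.exists_rightInverse_of_surjective
    (LinearMap.range_eq_top.2 restrict_surjective)
  have hφ (x : Module.Dual k L) :
      (rMinus ∘ₗ s) (x.comp (LinearMap.range rPlus).subtype) = rMinus x := by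
    rw [LinearMap.comp_apply, ← sub_eq_zero, ← map_sub, ← restrict_eq_zero_iff,
      LinearMap.sub_comp, sub_eq_zero]
    exact LinearMap.congr_fun hs _
  refine ⟨⟨rMinus ∘ₗ s, hφ, fun ψ hψ => ?_⟩, injective_and_range, ?_⟩
  · ext1 f
    obtain ⟨x, rfl⟩ := restrict_surjective f
    exact (hψ x).trans (hφ x).symm
  · obtain ⟨hinj, hrange⟩ := injective_and_range _ hφ
    exact ⟨(LinearEquiv.ofInjective _ hinj).trans (LinearEquiv.ofEq _ _ hrange)⟩
end

section
/- If r satisfies the classical Yang–Baxter equation c₁(r⊗r) + c₂(r⊗r) + c₃(r⊗r) = 0, then for all x, y, z ∈ Dual(L): x([r̃ᵀ(y), r̃ᵀ(z)]) + z([r̃(x), r̃(y)]) + y([r̃(x), r̃ᵀ(z)]) = 0. -/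
open TensorProduct

section Contraction

variable {k L : Type*} [CommRing k] [LieRing L] [LieAlgebra k L]

/-- Contraction of the first tensor factor with a functional. -/
noncomputable def contractFst (x : Module.Dual k L) : L ⊗[k] L →ₗ[k] L :=
  (TensorProduct.lid k L).toLinearMap ∘ₗ TensorProduct.map x LinearMap.id

/-- Contraction of the second tensor factor with a functional. -/
noncomputable def contractSnd (x : Module.Dual k L) : L ⊗[k] L →ₗ[k] L :=
  (TensorProduct.rid k L).toLinearMap ∘ₗ TensorProduct.map LinearMap.id x

/-- The functional `a ⊗ b ⊗ c ↦ x a * (y b * z c)` on the triple tensor product. -/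
noncomputable def tripleEval (x y z : Module.Dual k L) : L ⊗[k] (L ⊗[k] L) →ₗ[k] k :=
  LinearMap.mul' k k ∘ₗ TensorProduct.map x (LinearMap.mul' k k ∘ₗ TensorProduct.map y z)

@[simp]
theorem contractFst_tmul (x : Module.Dual k L) (a b : L) :
    contractFst x (a ⊗ₜ[k] b) = x a • b := by
  simp [contractFst]

@[simp]
theorem contractSnd_tmul (x : Module.Dual k L) (a b : L) :
    contractSnd x (a ⊗ₜ[k] b) = x b • a := by
  simp [contractSnd]

@[simp]
theorem tripleEval_tmul (x y z : Module.Dual k L) (a b c : L) :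
    tripleEval x y z (a ⊗ₜ[k] (b ⊗ₜ[k] c)) = x a * (y b * z c) := by
  simp [tripleEval]

theorem tripleEval_lie_fst_fst {c : (L ⊗[k] L) ⊗[k] (L ⊗[k] L) →ₗ[k] L ⊗[k] (L ⊗[k] L)}
    (hc : ∀ a b a' b' : L, c ((a ⊗ₜ b) ⊗ₜ (a' ⊗ₜ b')) = ⁅a, a'⁆ ⊗ₜ (b ⊗ₜ b'))
    (x y z : Module.Dual k L) (s t : L ⊗[k] L) :
    tripleEval x y z (c (s ⊗ₜ t)) = x ⁅contractSnd y s, contractSnd z t⁆ := by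
  induction s with
  | zero => simp
  | add s₁ s₂ h₁ h₂ => simp only [add_tmul, map_add, add_lie, h₁, h₂]
  | tmul a b =>
    induction t with
    | zero => simp
    | add t₁ t₂ h₁ h₂ => simp only [tmul_add, map_add, lie_add, h₁, h₂]
    | tmul a' b' =>
      simp only [hc, tripleEval_tmul, contractSnd_tmul, smul_lie, lie_smul,
        map_smul, smul_eq_mul]
      ring

theorem tripleEval_lie_snd_snd {c : (L ⊗[k] L) ⊗[k] (L ⊗[k] L) →ₗ[k] L ⊗[k] (L ⊗[k] L)}
    (hc : ∀ a b a' b' : L, c ((a ⊗ₜ b) ⊗ₜ (a' ⊗ₜ b')) = a ⊗ₜ (a' ⊗ₜ ⁅b, b'⁆))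
    (x y z : Module.Dual k L) (s t : L ⊗[k] L) :
    tripleEval x y z (c (s ⊗ₜ t)) = z ⁅contractFst x s, contractFst y t⁆ := by
  induction s with
  | zero => simp
  | add s₁ s₂ h₁ h₂ => simp only [add_tmul, map_add, add_lie, h₁, h₂]
  | tmul a b =>
    induction t with
    | zero => simp
    | add t₁ t₂ h₁ h₂ => simp only [tmul_add, map_add, lie_add, h₁, h₂]
    | tmul a' b' =>
      simp only [hc, tripleEval_tmul, contractFst_tmul, smul_lie, lie_smul,
        map_smul, smul_eq_mul]
      ring

theorem tripleEval_lie_snd_fst {c : (L ⊗[k] L) ⊗[k] (L ⊗[k] L) →ₗ[k] L ⊗[k] (L ⊗[k] L)}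
    (hc : ∀ a b a' b' : L, c ((a ⊗ₜ b) ⊗ₜ (a' ⊗ₜ b')) = a ⊗ₜ (⁅b, a'⁆ ⊗ₜ b'))
    (x y z : Module.Dual k L) (s t : L ⊗[k] L) :
    tripleEval x y z (c (s ⊗ₜ t)) = y ⁅contractFst x s, contractSnd z t⁆ := by
  induction s with
  | zero => simp
  | add s₁ s₂ h₁ h₂ => simp only [add_tmul, map_add, add_lie, h₁, h₂]
  | tmul a b =>
    induction t with
    | zero => simp
    | add t₁ t₂ h₁ h₂ => simp only [tmul_add, map_add, lie_add, h₁, h₂]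
    | tmul a' b' =>
      simp only [hc, tripleEval_tmul, contractFst_tmul, contractSnd_tmul, smul_lie, lie_smul,
        map_smul, smul_eq_mul]
      ring

end Contraction

/-- if `r` satisfies the classical Yang–Baxter equation
`[r₁₂,r₁₃] + [r₁₃,r₂₃] + [r₁₂,r₂₃] = 0` (with the three commutators expressed by
the maps `c₁, c₂, c₃` determined on simple tensors as in the context), then for
all `x, y, z ∈ Dual L`:
`x [r̃ᵀ y, r̃ᵀ z] + z [r̃ x, r̃ y] + y [r̃ x, r̃ᵀ z] = 0`. -/
theorem stmt_3 (k : Type*) [Field k] (L : Type*) [LieRing L] [LieAlgebra k L]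
    [Module.Finite k L] (r : L ⊗[k] L)
    (rPlus rMinus : Module.Dual k L →ₗ[k] L)
    (hPlus : ∀ x : Module.Dual k L,
      rPlus x = (TensorProduct.lid k L) ((TensorProduct.map x LinearMap.id) r))
    (hMinus : ∀ x : Module.Dual k L,
      rMinus x = (TensorProduct.rid k L) ((TensorProduct.map LinearMap.id x) r))
    (c₁ c₂ c₃ : (L ⊗[k] L) ⊗[k] (L ⊗[k] L) →ₗ[k] L ⊗[k] (L ⊗[k] L))
    (hc₁ : ∀ a b c d : L, c₁ ((a ⊗ₜ b) ⊗ₜ (c ⊗ₜ d)) = ⁅a, c⁆ ⊗ₜ (b ⊗ₜ d))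
    (hc₂ : ∀ a b c d : L, c₂ ((a ⊗ₜ b) ⊗ₜ (c ⊗ₜ d)) = a ⊗ₜ (c ⊗ₜ ⁅b, d⁆))
    (hc₃ : ∀ a b c d : L, c₃ ((a ⊗ₜ b) ⊗ₜ (c ⊗ₜ d)) = a ⊗ₜ (⁅b, c⁆ ⊗ₜ d))
    (CYBE : c₁ (r ⊗ₜ r) + c₂ (r ⊗ₜ r) + c₃ (r ⊗ₜ r) = 0) :
    ∀ x y z : Module.Dual k L,
      x ⁅rMinus y, rMinus z⁆ + z ⁅rPlus x, rPlus y⁆ + y ⁅rPlus x, rMinus z⁆ = 0 := by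
  intro x y z
  have hP : ∀ w, rPlus w = contractFst w r := hPlus
  have hM : ∀ w, rMinus w = contractSnd w r := hMinus
  simpa only [map_add, map_zero, tripleEval_lie_fst_fst hc₁, tripleEval_lie_snd_snd hc₂,
    tripleEval_lie_snd_fst hc₃, hP, hM] using congrArg (tripleEval x y z) CYBE
end

section
/- Assume that for all x, y, z ∈ Dual(L): x([r̃ᵀ(y), r̃ᵀ(z)]) + z([r̃(x), r̃(y)]) + y([r̃(x), r̃ᵀ(z)]) = 0. Then for all x, z ∈ Dual(L) the mixed commutator satisfies [r̃(x), r̃ᵀ(z)] = r̃ᵀ(r̃(x) ▷ z) − r̃(r̃ᵀ(z) ▷ x). -/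
open TensorProduct

/-- The two contractions of a tensor against functionals are adjoint to each other. -/
theorem dual_apply_rid_map_eq_dual_apply_lid_map {k L : Type*} [CommRing k] [AddCommGroup L]
    [Module k L] (r : L ⊗[k] L) (x y : Module.Dual k L) :
    y (TensorProduct.rid k L (TensorProduct.map LinearMap.id x r)) =
      x (TensorProduct.lid k L (TensorProduct.map y LinearMap.id r)) := by
  induction r with
  | zero => simp
  | tmul a b => simp [mul_comm]
  | add a b ha hb => simp only [map_add, ha, hb]

/-- assuming the pairing identity
`x [r̃ᵀ y, r̃ᵀ z] + z [r̃ x, r̃ y] + y [r̃ x, r̃ᵀ z] = 0` for all `x, y, z`,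
the mixed commutator satisfies
`[r̃ x, r̃ᵀ z] = r̃ᵀ (r̃ x ▷ z) − r̃ (r̃ᵀ z ▷ x)`,
where `(a ▷ w) b = −w ⁅a, b⁆` is the coadjoint action. -/
theorem stmt_4 (k : Type*) [Field k] (L : Type*) [LieRing L] [LieAlgebra k L]
    [Module.Finite k L] (r : L ⊗[k] L)
    (rPlus rMinus : Module.Dual k L →ₗ[k] L)
    (hPlus : ∀ x : Module.Dual k L,
      rPlus x = (TensorProduct.lid k L) ((TensorProduct.map x LinearMap.id) r))
    (hMinus : ∀ x : Module.Dual k L,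
      rMinus x = (TensorProduct.rid k L) ((TensorProduct.map LinearMap.id x) r))
    (coad : L → Module.Dual k L → Module.Dual k L)
    (hcoad : ∀ (a : L) (w : Module.Dual k L) (b : L), coad a w b = - w ⁅a, b⁆)
    (H : ∀ x y z : Module.Dual k L,
      x ⁅rMinus y, rMinus z⁆ + z ⁅rPlus x, rPlus y⁆ + y ⁅rPlus x, rMinus z⁆ = 0) :
    ∀ x z : Module.Dual k L,
      ⁅rPlus x, rMinus z⁆ =
        rMinus (coad (rPlus x) z) - rPlus (coad (rMinus z) x) := by
  intro x z
  have adj (y w : Module.Dual k L) : y (rMinus w) = w (rPlus y) := by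
    rw [hMinus, hPlus, dual_apply_rid_map_eq_dual_apply_lid_map]
  rw [← sub_eq_zero, ← Module.forall_dual_apply_eq_zero_iff k]
  intro y
  rw [map_sub, map_sub, adj y (coad (rPlus x) z), ← adj (coad (rMinus z) x) y, hcoad, hcoad,
    ← lie_skew (rMinus z), map_neg]
  linear_combination H x y z
end

section
/- Assume that for all x, y, z ∈ Dual(L): x([r̃ᵀ(y), r̃ᵀ(z)]) + z([r̃(x), r̃(y)]) + y([r̃(x), r̃ᵀ(z)]) = 0. Then for all x, y ∈ Dual(L): [r̃(x), r̃(y)] = r̃( (r̃ᵀ(y) ▷ x) + (r̃(x) ▷ y) ). In particular the range L₊ = range(r̃) is a Lie subalgebra of L. -/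
open TensorProduct

/-- The two contractions of a tensor are transposes of each other. -/
theorem dual_lid_map_eq_dual_rid_map {k M N : Type*} [Field k] [AddCommGroup M] [Module k M]
    [AddCommGroup N] [Module k N] (r : M ⊗[k] N) (w : Module.Dual k M) (z : Module.Dual k N) :
    z (TensorProduct.lid k N (TensorProduct.map w LinearMap.id r)) =
      w (TensorProduct.rid k M (TensorProduct.map LinearMap.id z r)) := by
  induction r with
  | zero => simp
  | tmul a b => simp [mul_comm]
  | add s t hs ht => simp only [map_add, hs, ht]

/-- assuming the pairing identity of the CYBE, for all `x, y`:
`[r̃ x, r̃ y] = r̃ ((r̃ᵀ y ▷ x) + (r̃ x ▷ y))`; in particular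
`L₊ = range r̃` is a Lie subalgebra of `L`. -/
theorem stmt_5 (k : Type*) [Field k] (L : Type*) [LieRing L] [LieAlgebra k L]
    [Module.Finite k L] (r : L ⊗[k] L)
    (rPlus rMinus : Module.Dual k L →ₗ[k] L)
    (hPlus : ∀ x : Module.Dual k L,
      rPlus x = (TensorProduct.lid k L) ((TensorProduct.map x LinearMap.id) r))
    (hMinus : ∀ x : Module.Dual k L,
      rMinus x = (TensorProduct.rid k L) ((TensorProduct.map LinearMap.id x) r))
    (coad : L → Module.Dual k L → Module.Dual k L)
    (hcoad : ∀ (a : L) (w : Module.Dual k L) (b : L), coad a w b = - w ⁅a, b⁆)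
    (H : ∀ x y z : Module.Dual k L,
      x ⁅rMinus y, rMinus z⁆ + z ⁅rPlus x, rPlus y⁆ + y ⁅rPlus x, rMinus z⁆ = 0) :
    (∀ x y : Module.Dual k L,
      ⁅rPlus x, rPlus y⁆ = rPlus (coad (rMinus y) x + coad (rPlus x) y)) ∧
    (∀ a b : L, a ∈ LinearMap.range rPlus → b ∈ LinearMap.range rPlus →
      ⁅a, b⁆ ∈ LinearMap.range rPlus) := by
  have bracket_eq (x y : Module.Dual k L) :
      ⁅rPlus x, rPlus y⁆ = rPlus (coad (rMinus y) x + coad (rPlus x) y) := by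
    rw [← sub_eq_zero, ← Module.forall_dual_apply_eq_zero_iff k]
    intro z
    have transpose (w : Module.Dual k L) : z (rPlus w) = w (rMinus z) := by
      rw [hPlus, hMinus, dual_lid_map_eq_dual_rid_map]
    rw [map_sub, transpose, LinearMap.add_apply, hcoad, hcoad]
    linear_combination H x y z
  refine ⟨bracket_eq, ?_⟩
  rintro _ _ ⟨x, rfl⟩ ⟨y, rfl⟩
  exact ⟨_, (bracket_eq x y).symm⟩
end

section
/- Assume that for all x, y, z ∈ Dual(L): x([r̃ᵀ(y), r̃ᵀ(z)]) + z([r̃(x), r̃(y)]) + y([r̃(x), r̃ᵀ(z)]) = 0. Then for all y, z ∈ Dual(L): [r̃ᵀ(y), r̃ᵀ(z)] = −r̃ᵀ( (r̃(y) ▷ z) + (r̃ᵀ(z) ▷ y) ). In particular the range L₋ = range(r̃ᵀ) is a Lie subalgebra of L. -/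
open TensorProduct

/-- The two contractions of a tensor `r ∈ V ⊗ V` are adjoint to each other. -/
lemma dual_rid_map_eq_dual_lid_map {k V : Type*} [CommRing k] [AddCommGroup V] [Module k V]
    (r : V ⊗[k] V) (x w : Module.Dual k V) :
    w (TensorProduct.rid k V (TensorProduct.map LinearMap.id x r)) =
      x (TensorProduct.lid k V (TensorProduct.map w LinearMap.id r)) := by
  induction r using TensorProduct.induction_on with
  | zero => simp
  | tmul a b => simp [mul_comm]
  | add a b ha hb => simp only [map_add, ha, hb]

/-- assuming the pairing identity of the CYBE, for all `x, y`:
`[r̃ᵀ y, r̃ᵀ z] = −r̃ᵀ ((r̃ y ▷ z) + (r̃ᵀ z ▷ y))`; in particular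
`L₋ = range r̃ᵀ` is a Lie subalgebra of `L`. -/
theorem stmt_6 (k : Type*) [Field k] (L : Type*) [LieRing L] [LieAlgebra k L]
    [Module.Finite k L] (r : L ⊗[k] L)
    (rPlus rMinus : Module.Dual k L →ₗ[k] L)
    (hPlus : ∀ x : Module.Dual k L,
      rPlus x = (TensorProduct.lid k L) ((TensorProduct.map x LinearMap.id) r))
    (hMinus : ∀ x : Module.Dual k L,
      rMinus x = (TensorProduct.rid k L) ((TensorProduct.map LinearMap.id x) r))
    (coad : L → Module.Dual k L → Module.Dual k L)
    (hcoad : ∀ (a : L) (w : Module.Dual k L) (b : L), coad a w b = - w ⁅a, b⁆)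
    (H : ∀ x y z : Module.Dual k L,
      x ⁅rMinus y, rMinus z⁆ + z ⁅rPlus x, rPlus y⁆ + y ⁅rPlus x, rMinus z⁆ = 0) :
    (∀ y z : Module.Dual k L,
      ⁅rMinus y, rMinus z⁆ = - rMinus (coad (rPlus y) z + coad (rMinus z) y)) ∧
    (∀ a b : L, a ∈ LinearMap.range rMinus → b ∈ LinearMap.range rMinus →
      ⁅a, b⁆ ∈ LinearMap.range rMinus) := by
  have hbracket : ∀ y z : Module.Dual k L,
      ⁅rMinus y, rMinus z⁆ = - rMinus (coad (rPlus y) z + coad (rMinus z) y) := by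
    intro y z
    rw [← sub_eq_zero, ← Module.forall_dual_apply_eq_zero_iff k]
    intro x
    rw [map_sub, map_neg, hMinus (_ + _), dual_rid_map_eq_dual_lid_map, ← hPlus,
      LinearMap.add_apply, hcoad, hcoad, ← lie_skew (rPlus y), ← lie_skew (rMinus z) (rPlus x),
      map_neg, map_neg]
    linear_combination H x y z
  refine ⟨hbracket, ?_⟩
  rintro _ _ ⟨y, rfl⟩ ⟨z, rfl⟩
  rw [hbracket]
  exact neg_mem (LinearMap.mem_range_self _ _)
end
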